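/- Let l ≥ 2, let ξ ∈ V_l ⊖ S_l, and let m, n, m', n' ≥ 0 be integers with m + n = m' + n'. Then q_l(h_{m'}(h_{n'}^r(ξ_{m,n}))) = (L−1)^{m+n}·ξ if (m,n) = (m',n'), and q_l(h_{m'}(h_{n'}^r(ξ_{m,n}))) = 0 otherwise. -/

import Mathlib

noncomputable section

open scoped ComplexInnerProductSpace

namespace UCoxMasa

/-- The universal Coxeter matrix on `Fin L`: all off-diagonal entries are `0` (representing ∞). -/
def Mat (L : ℕ) : CoxeterMatrix (Fin L) where
  M := fun i j => if i = j then 1 else 0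
  isSymm := by
    ext i j
    by_cases h : i = j <;> simp [Matrix.transpose, h, eq_comm]
  diagonal := fun i => by simp
  off_diagonal := fun i j h => by simp [h]

/-- The universal Coxeter group on `L` generators: free product of `L` copies of `ℤ/2ℤ`. -/
abbrev W (L : ℕ) : Type := (Mat L).Group

/-- The distinguished Coxeter system of `W L`. -/
def cs (L : ℕ) : CoxeterSystem (Mat L) (W L) := CoxeterMatrix.toCoxeterSystem (Mat L)

/-- The simple reflection associated to `i : Fin L`. -/
def σ {L : ℕ} (i : Fin L) : W L := (cs L).simple i

/-- Word length on `W L` with respect to the generating set of simple reflections. -/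
def len {L : ℕ} (w : W L) : ℕ := (cs L).length w

/-- The Hilbert space `ℓ²(W)`. -/
abbrev H (L : ℕ) : Type := lp (fun _ : W L => ℂ) 2

/-- The standard orthonormal basis vector `δ_w` of `ℓ²(W)`. -/
def δ {L : ℕ} (w : W L) : H L :=
  letI := Classical.decEq (W L)
  lp.single 2 w 1

/-- `V l`: the linear span of `{δ_w : ℓ(w) = l}`. -/
def V (L : ℕ) (l : ℕ) : Submodule ℂ (H L) :=
  Submodule.span ℂ {x : H L | ∃ w : W L, len w = l ∧ x = δ w}

/-- `S_l`: the linear span of `q_l(h V_{l-1}) ∪ q_l(R_h V_{l-1})`,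
given the projections `Q`, the operator `h` and the right operator `Rh`. -/
def Sl (L : ℕ) (Q : ℕ → (H L →L[ℂ] H L)) (h Rh : H L →L[ℂ] H L) (l : ℕ) :
    Submodule ℂ (H L) :=
  Submodule.span ℂ
    ({x : H L | ∃ y ∈ V L (l - 1), x = Q l (h y)} ∪
      {x : H L | ∃ y ∈ V L (l - 1), x = Q l (Rh y)})

end UCoxMasa


namespace UCoxMasa

section

variable {L : ℕ}

/-- Left multiplication by the letter `s`, on words without repeated adjacent letters. -/
def consCancel (s : Fin L) (l : List (Fin L)) : List (Fin L) :=
  if l.head? = some s then l.tail else s :: l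

lemma isChain_consCancel (s : Fin L) {l : List (Fin L)} (hl : l.IsChain (· ≠ ·)) :
    (consCancel s l).IsChain (· ≠ ·) := by
  unfold consCancel
  split_ifs with h
  · exact hl.tail
  · rw [List.isChain_cons]
    exact ⟨fun y hy hsy => h (hsy ▸ hy), hl⟩

lemma consCancel_consCancel (s : Fin L) {l : List (Fin L)} (hl : l.IsChain (· ≠ ·)) :
    consCancel s (consCancel s l) = l := by
  rcases l with _ | ⟨a, l⟩
  · simp [consCancel]
  · rw [List.isChain_cons] at hl
    by_cases h : a = s
    · subst h
      have : l.head? ≠ some a := fun h => hl.1 a h rfl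
      simp [consCancel, this]
    · simp [consCancel, h]

/-- Left multiplication by the letter `s`, as a permutation of the reduced words. -/
def consPerm (s : Fin L) : Equiv.Perm {l : List (Fin L) // l.IsChain (· ≠ ·)} where
  toFun l := ⟨consCancel s l.1, isChain_consCancel s l.2⟩
  invFun l := ⟨consCancel s l.1, isChain_consCancel s l.2⟩
  left_inv l := Subtype.ext (consCancel_consCancel s l.2)
  right_inv l := Subtype.ext (consCancel_consCancel s l.2)

lemma consPerm_isLiftable : (Mat L).IsLiftable (consPerm (L := L)) := by
  intro i j
  by_cases h : i = j
  · subst h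
    simp only [Mat, if_true, pow_one]
    ext1 l
    exact Subtype.ext (consCancel_consCancel i l.2)
  · simp [Mat, h]

/-- The unique reduced word of an element of `W L`. -/
def nf (w : W L) : List (Fin L) :=
  ((cs L).lift ⟨consPerm, consPerm_isLiftable⟩ w ⟨[], List.isChain_nil⟩).1

lemma isChain_nf (w : W L) : (nf w).IsChain (· ≠ ·) :=
  ((cs L).lift ⟨consPerm, consPerm_isLiftable⟩ w ⟨[], List.isChain_nil⟩).2

lemma nf_one : nf (1 : W L) = [] := by simp [nf]

lemma nf_simple_mul (s : Fin L) (w : W L) : nf (σ s * w) = consCancel s (nf w) := by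
  simp only [nf, σ, map_mul, CoxeterSystem.lift_apply_simple, Equiv.Perm.mul_apply]
  rfl

lemma wordProd_nf (w : W L) : (cs L).wordProd (nf w) = w := by
  induction w using (cs L).simple_induction_left with
  | one => simp [nf_one]
  | mul_simple_left w i ih =>
    have : nf ((cs L).simple i * w) = consCancel i (nf w) := nf_simple_mul i w
    rw [this, consCancel]
    split_ifs with h
    · obtain ⟨t, ht⟩ := List.head?_eq_some_iff.1 h
      rw [ht, CoxeterSystem.wordProd_cons] at ih
      rw [ht, ← ih]
      simp
    · rw [CoxeterSystem.wordProd_cons, ih]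

lemma nf_wordProd {l : List (Fin L)} (hl : l.IsChain (· ≠ ·)) : nf ((cs L).wordProd l) = l := by
  induction l with
  | nil => simp [nf_one]
  | cons a l ih =>
    rw [List.isChain_cons] at hl
    rw [CoxeterSystem.wordProd_cons]
    have := nf_simple_mul a ((cs L).wordProd l)
    rw [σ, ih hl.2, consCancel, if_neg (show l.head? ≠ some a from fun h => hl.1 a h rfl)] at this
    exact this

lemma length_nf_wordProd_le (l : List (Fin L)) : (nf ((cs L).wordProd l)).length ≤ l.length := by
  induction l with
  | nil => simp [nf_one]
  | cons a l ih =>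
    have := nf_simple_mul a ((cs L).wordProd l)
    rw [σ, ← CoxeterSystem.wordProd_cons] at this
    rw [this, consCancel]
    split_ifs <;> simp <;> omega

lemma length_nf (w : W L) : (nf w).length = len w := by
  apply le_antisymm
  · obtain ⟨l, hl, rfl⟩ := (cs L).exists_isReduced w
    rw [len, hl.eq]
    exact length_nf_wordProd_le l
  · conv_lhs => rw [← wordProd_nf w]
    exact (cs L).length_wordProd_le _

lemma nf_inv (w : W L) : nf w⁻¹ = (nf w).reverse := by
  conv_lhs => rw [← wordProd_nf w, ← CoxeterSystem.wordProd_reverse]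
  apply nf_wordProd
  rw [List.isChain_reverse]
  exact (isChain_nf w).imp fun _ _ h => h.symm

lemma nf_injective : Function.Injective (nf (L := L)) :=
  Function.LeftInverse.injective wordProd_nf

lemma len_inv (w : W L) : len w⁻¹ = len w := (cs L).length_inv w

lemma simple_inv (s : Fin L) : (σ s : W L)⁻¹ = σ s := (cs L).inv_simple s

lemma len_simple_mul_lt_iff (s : Fin L) (w : W L) :
    len (σ s * w) < len w ↔ (nf w).head? = some s := by
  rw [← length_nf, ← length_nf, nf_simple_mul, consCancel]
  split_ifs with h
  · obtain ⟨t, ht⟩ := List.head?_eq_some_iff.1 h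
    simp [ht]
  · simp [h]

lemma len_mul_simple_eq_inv (s : Fin L) (w : W L) : len (w * σ s) = len (σ s * w⁻¹) := by
  rw [← len_inv, mul_inv_rev, simple_inv]

lemma len_mul_simple_lt_iff (s : Fin L) (w : W L) :
    len (w * σ s) < len w ↔ (nf w).getLast? = some s := by
  rw [len_mul_simple_eq_inv, ← len_inv w, len_simple_mul_lt_iff, nf_inv, List.head?_reverse]

/-- A left ascent of a nontrivial element keeps its right descents. -/
lemma len_mul_simple_lt_iff_of_ascent {s t : Fin L} {v : W L} (hv : 1 ≤ len v)
    (hs : len v < len (σ s * v)) :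
    len (σ s * v * σ t) < len (σ s * v) ↔ len (v * σ t) < len v := by
  have h : (nf v).head? ≠ some s := by rw [Ne, ← len_simple_mul_lt_iff]; omega
  have hv' : nf v ≠ [] := by
    intro h
    rw [← length_nf, h] at hv
    simp at hv
  rw [len_mul_simple_lt_iff, len_mul_simple_lt_iff, nf_simple_mul, consCancel, if_neg h,
    List.getLast?_cons_of_ne_nil hv']

lemma finite_len_eq (n : ℕ) : {w : W L | len w = n}.Finite := by
  refine Set.Finite.of_finite_image (f := nf) ?_ nf_injective.injOn
  refine (List.finite_length_eq (Fin L) n).subset ?_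
  rintro _ ⟨w, hw, rfl⟩
  simpa [length_nf] using hw

/-- The common features of the actions of the letters on `W L` by left and right
multiplication. -/
structure IsLetterAction (act : Fin L → W L → W L) : Prop where
  involutive (s : Fin L) (w : W L) : act s (act s w) = w
  len_act (s : Fin L) (w : W L) : len (act s w) = len w + 1 ∨ len (act s w) + 1 = len w
  existsUnique_descent (w : W L) (hw : 1 ≤ len w) : ∃! s, len (act s w) < len w

lemma isLetterAction_left : IsLetterAction (fun (s : Fin L) (w : W L) => σ s * w) where
  involutive s w := (cs L).simple_mul_simple_cancel_left s
  len_act s w := (cs L).length_simple_mul w s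
  existsUnique_descent w hw := by
    simp only [len_simple_mul_lt_iff]
    rw [← length_nf] at hw
    rcases h : nf w with _ | ⟨a, l⟩
    · simp [h] at hw
    · simp

lemma isLetterAction_right : IsLetterAction (fun (s : Fin L) (w : W L) => w * σ s) where
  involutive s w := (cs L).simple_mul_simple_cancel_right s
  len_act s w := (cs L).length_mul_simple w s
  existsUnique_descent w hw := by
    simpa only [len_mul_simple_eq_inv, len_inv] using
      isLetterAction_left.existsUnique_descent w⁻¹ (by rwa [len_inv])

/-- Two commuting letter actions, each of which does not affect the descents of the other away
from short elements. -/
structure AreIndependent (a b : Fin L → W L → W L) : Prop where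
  comm (s t : Fin L) (w : W L) : a s (b t w) = b t (a s w)
  descent_iff (s t : Fin L) (v : W L) (hv : 1 ≤ len v) (hs : len v < len (a s v)) :
    len (b t (a s v)) < len (a s v) ↔ len (b t v) < len v

lemma areIndependent_left_right : AreIndependent (fun (s : Fin L) (w : W L) => σ s * w)
    (fun (s : Fin L) (w : W L) => w * σ s) where
  comm _ _ _ := (mul_assoc _ _ _).symm
  descent_iff _ _ _ hv hs := len_mul_simple_lt_iff_of_ascent hv hs

lemma areIndependent_right_left : AreIndependent (fun (s : Fin L) (w : W L) => w * σ s)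
    (fun (s : Fin L) (w : W L) => σ s * w) where
  comm _ _ _ := mul_assoc _ _ _
  descent_iff s t v hv hs := by
    have := len_mul_simple_lt_iff_of_ascent (s := s) (t := t) (v := v⁻¹) (by rwa [len_inv])
      (by rwa [← len_mul_simple_eq_inv, len_inv])
    have h₁ : len (σ s * v⁻¹ * σ t) = len (σ t * (v * σ s)) := by
      rw [len_mul_simple_eq_inv, mul_inv_rev, inv_inv, simple_inv]
    have h₂ : len (v⁻¹ * σ t) = len (σ t * v) := by rw [len_mul_simple_eq_inv, inv_inv]
    rwa [h₁, ← len_mul_simple_eq_inv, len_inv, h₂] at this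

open Classical in
/-- The operator that moves each `w` by those letters which change its length by `ε`. -/
def shift (ε : ℤ) (act : Fin L → W L → W L) : Module.End ℂ (W L →₀ ℂ) :=
  Finsupp.linearCombination ℂ fun v =>
    ∑ s, if (len (act s v) : ℤ) = len v + ε then Finsupp.single (act s v) 1 else 0

/-- The finitely supported functions on the sphere of radius `k`. -/
def sphere (L : ℕ) (k : ℤ) : Submodule ℂ (W L →₀ ℂ) :=
  Finsupp.supported ℂ ℂ {w : W L | (len w : ℤ) = k}

lemma single_mem_sphere (w : W L) : (Finsupp.single w 1 : W L →₀ ℂ) ∈ sphere L (len w) :=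
  Finsupp.single_mem_supported ℂ 1 rfl

lemma single_mem_sphere_of_eq {w : W L} {k : ℤ} (h : (len w : ℤ) = k) :
    (Finsupp.single w 1 : W L →₀ ℂ) ∈ sphere L k :=
  h ▸ single_mem_sphere w

lemma sphere_induction {k : ℤ} {P : ∀ f : W L →₀ ℂ, f ∈ sphere L k → Prop}
    (single : ∀ w (hw : (len w : ℤ) = k), P (Finsupp.single w 1) (single_mem_sphere_of_eq hw))
    (zero : P 0 (zero_mem _))
    (add : ∀ f g hf hg, P f hf → P g hg → P (f + g) (add_mem hf hg))
    (smul : ∀ (c : ℂ) f hf, P f hf → P (c • f) (Submodule.smul_mem _ c hf))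
    {f : W L →₀ ℂ} (hf : f ∈ sphere L k) : P f hf := by
  have h := hf
  rw [sphere, Finsupp.supported_eq_span_single] at h
  suffices ∃ hf, P f hf from this.2
  clear hf
  induction h using Submodule.span_induction with
  | mem x hx => obtain ⟨w, hw, rfl⟩ := hx; exact ⟨_, single w hw⟩
  | zero => exact ⟨_, zero⟩
  | add f g _ _ hf hg =>
    obtain ⟨_, hf⟩ := hf
    obtain ⟨_, hg⟩ := hg
    exact ⟨_, add _ _ _ _ hf hg⟩
  | smul c f _ hf =>
    obtain ⟨_, hf⟩ := hf
    exact ⟨_, smul _ _ _ hf⟩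

open Classical in
lemma shift_single (ε : ℤ) (act : Fin L → W L → W L) (v : W L) :
    shift ε act (Finsupp.single v 1) =
      ∑ s, if (len (act s v) : ℤ) = len v + ε then Finsupp.single (act s v) 1 else 0 := by
  simp [shift]

lemma shift_mem_sphere (ε : ℤ) (act : Fin L → W L → W L) {k : ℤ} {f : W L →₀ ℂ}
    (hf : f ∈ sphere L k) : shift ε act f ∈ sphere L (k + ε) := by
  classical
  induction hf using sphere_induction with
  | single w hw =>
    rw [shift_single]
    refine Submodule.sum_mem _ fun s _ => ?_
    split_ifs with h
    · exact single_mem_sphere_of_eq (by rw [h, hw])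
    · exact zero_mem _
  | zero => simp
  | add f g _ _ hf hg => rw [map_add]; exact add_mem hf hg
  | smul c f _ hf => rw [map_smul]; exact Submodule.smul_mem _ _ hf

lemma shift_pow_mem_sphere (ε : ℤ) (act : Fin L → W L → W L) {k : ℤ} {f : W L →₀ ℂ}
    (hf : f ∈ sphere L k) (n : ℕ) : (shift ε act ^ n) f ∈ sphere L (k + n * ε) := by
  induction n with
  | zero => simpa using hf
  | succ n ih =>
    rw [pow_succ', Module.End.mul_apply]
    have := shift_mem_sphere ε act ih
    rwa [add_assoc, ← add_one_mul, ← Nat.cast_succ] at this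

lemma shift_neg_apply {ε : ℤ} {act : Fin L → W L → W L} (ha : IsLetterAction act)
    (f : W L →₀ ℂ) (v : W L) :
    shift (-ε) act f v = ∑ s, if (len (act s v) : ℤ) = len v + ε then f (act s v) else 0 := by
  classical
  induction f using Finsupp.induction_linear with
  | zero => simp
  | add f g hf hg =>
    rw [map_add, Finsupp.add_apply, hf, hg, ← Finset.sum_add_distrib]
    refine Finset.sum_congr rfl fun s _ => ?_
    split_ifs <;> simp
  | single x c =>
    have hx : Finsupp.single x c = c • (Finsupp.single x 1 : W L →₀ ℂ) := by simp
    rw [hx, map_smul, shift_single, Finsupp.smul_apply, Finsupp.finsetSum_apply, smul_eq_mul,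
      Finset.mul_sum]
    refine Finset.sum_congr rfl fun s _ => ?_
    by_cases h : act s x = v
    · subst h
      rw [ha.involutive]
      have : ((len (act s x) : ℤ) = len x + -ε) ↔ ((len x : ℤ) = len (act s x) + ε) := by omega
      simp only [this]
      split_ifs <;> simp
    · have h' : x ≠ act s v := fun hx => h (by rw [hx, ha.involutive])
      split_ifs <;> simp [h, h']

lemma IsLetterAction.shift_neg_shift_one {act : Fin L → W L → W L} (ha : IsLetterAction act)
    {k : ℤ} (hk : 1 ≤ k) {f : W L →₀ ℂ} (hf : f ∈ sphere L k) :
    shift (-1) act (shift 1 act f) = ((L : ℂ) - 1) • f := by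
  classical
  induction hf using sphere_induction with
  | single w hw =>
    have key (s : Fin L) (hs : (len (act s w) : ℤ) = len w + 1) :
        shift (-1) act (Finsupp.single (act s w) 1) = Finsupp.single w 1 := by
      rw [shift_single, Finset.sum_eq_single s]
      · rw [ha.involutive, if_pos (by omega)]
      · intro t _ hts
        rw [if_neg]
        intro ht
        refine hts ((ha.existsUnique_descent (act s w) (by omega)).unique ?_ ?_)
        · omega
        · rw [ha.involutive]; omega
      · simp
    obtain ⟨r, hr, hru⟩ := ha.existsUnique_descent w (by omega)
    have hL : 1 ≤ L := by have := r.2; omega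
    have hdec (s : Fin L) : (len (act s w) : ℤ) = len w + 1 ↔ s ≠ r := by
      constructor
      · rintro h rfl
        omega
      · intro h
        have h₁ := ha.len_act s w
        have h₂ := mt (hru s) h
        omega
    rw [shift_single, map_sum]
    have : ∀ s ∈ Finset.univ, (shift (-1) act) (if (len (act s w) : ℤ) = len w + 1 then
        Finsupp.single (act s w) (1 : ℂ) else 0) =
        if s ≠ r then Finsupp.single w 1 else 0 := by
      intro s _
      by_cases h : s = r
      · rw [if_neg (mt (hdec s).1 (not_not.2 h)), if_neg (not_not.2 h), map_zero]
      · rw [if_pos ((hdec s).2 h), if_pos h, key s ((hdec s).2 h)]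
    rw [Finset.sum_congr rfl this, ← Finset.sum_filter, Finset.sum_const, Finset.filter_ne',
      Finset.card_erase_of_mem (Finset.mem_univ _), Finset.card_univ, Fintype.card_fin,
      ← Nat.cast_smul_eq_nsmul ℂ, Nat.cast_sub hL, Nat.cast_one]
  | zero => simp
  | add f g _ _ hf hg => rw [map_add, map_add, hf, hg, smul_add]
  | smul c f _ hf => rw [map_smul, map_smul, hf, smul_comm]

lemma AreIndependent.shift_neg_shift_one {a b : Fin L → W L → W L} (hab : AreIndependent a b)
    (ha : IsLetterAction a) (hb : IsLetterAction b) {k : ℤ} (hk : 2 ≤ k) {f : W L →₀ ℂ}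
    (hf : f ∈ sphere L k) :
    shift (-1) b (shift 1 a f) = shift 1 a (shift (-1) b f) := by
  classical
  induction hf using sphere_induction with
  | single v hv =>
    have hl : shift (-1) b (shift 1 a (Finsupp.single v 1)) =
        ∑ s, ∑ t, if (len (a s v) : ℤ) = len v + 1 ∧ (len (b t (a s v)) : ℤ) = len (a s v) + -1
          then Finsupp.single (b t (a s v)) 1 else 0 := by
      rw [shift_single, map_sum]
      refine Finset.sum_congr rfl fun s _ => ?_
      by_cases h : (len (a s v) : ℤ) = len v + 1
      · rw [if_pos h, shift_single]
        simp only [h, true_and]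
      · simp [h]
    have hr : shift 1 a (shift (-1) b (Finsupp.single v 1)) =
        ∑ t, ∑ s, if (len (b t v) : ℤ) = len v + -1 ∧ (len (a s (b t v)) : ℤ) = len (b t v) + 1
          then Finsupp.single (a s (b t v)) 1 else 0 := by
      rw [shift_single, map_sum]
      refine Finset.sum_congr rfl fun t _ => ?_
      by_cases h : (len (b t v) : ℤ) = len v + -1
      · rw [if_pos h, shift_single]
        simp only [h, true_and]
      · simp [h]
    rw [hl, hr, Finset.sum_comm]
    refine Finset.sum_congr rfl fun t _ => Finset.sum_congr rfl fun s _ => ?_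
    rw [hab.comm]
    refine if_congr ?_ rfl rfl
    have h₁ := hab.descent_iff s t v
    have h₂ := hab.descent_iff s t (b t v)
    rw [hab.comm, hb.involutive, hb.involutive] at h₂
    have h₃ := ha.len_act s v
    have h₄ := hb.len_act t v
    have h₅ := ha.len_act s (b t v)
    have h₆ := hb.len_act t (a s v)
    rw [hab.comm] at h₅
    omega
  | zero => simp
  | add f g _ _ hf hg => simp only [map_add, hf, hg]
  | smul c f _ hf => simp only [map_smul, hf]

lemma IsLetterAction.shift_neg_pow_shift_one_pow {act : Fin L → W L → W L}
    (ha : IsLetterAction act) {k : ℤ} (hk : 1 ≤ k) {f : W L →₀ ℂ} (hf : f ∈ sphere L k) (n : ℕ) :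
    (shift (-1) act ^ n) ((shift 1 act ^ n) f) = ((L : ℂ) - 1) ^ n • f := by
  induction n with
  | zero => simp
  | succ n ih =>
    rw [pow_succ, pow_succ', Module.End.mul_apply, Module.End.mul_apply,
      ha.shift_neg_shift_one (k := k + n * 1) (by omega) (shift_pow_mem_sphere 1 act hf n),
      map_smul, ih, smul_smul, pow_succ']

lemma AreIndependent.shift_neg_shift_one_pow {a b : Fin L → W L → W L}
    (hab : AreIndependent a b) (ha : IsLetterAction a) (hb : IsLetterAction b) {k : ℤ}
    (hk : 2 ≤ k) {f : W L →₀ ℂ} (hf : f ∈ sphere L k) (m : ℕ) :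
    shift (-1) b ((shift 1 a ^ m) f) = (shift 1 a ^ m) (shift (-1) b f) := by
  induction m with
  | zero => simp
  | succ m ih =>
    rw [pow_succ', Module.End.mul_apply, Module.End.mul_apply,
      hab.shift_neg_shift_one ha hb (k := k + m * 1) (by omega) (shift_pow_mem_sphere 1 a hf m), ih]

lemma AreIndependent.shift_neg_pow_shift_one_pow {a b : Fin L → W L → W L}
    (hab : AreIndependent a b) (ha : IsLetterAction a) (hb : IsLetterAction b) {k : ℤ} (n : ℕ)
    (hk : n + 1 ≤ k) {f : W L →₀ ℂ} (hf : f ∈ sphere L k) (m : ℕ) :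
    (shift (-1) b ^ n) ((shift 1 a ^ m) f) = (shift 1 a ^ m) ((shift (-1) b ^ n) f) := by
  induction n generalizing k f with
  | zero => simp
  | succ n ih =>
    push_cast at hk
    rw [pow_succ, Module.End.mul_apply, Module.End.mul_apply,
      hab.shift_neg_shift_one_pow ha hb (by omega) hf,
      ih (k := k + -1) (by omega) (shift_mem_sphere _ _ hf)]

/-- The orthogonality relations between the vectors obtained from a vector on the sphere of
radius `k ≥ 2` which is killed by the lowering operators of both actions. -/
lemma shift_orthogonality {a b : Fin L → W L → W L} (hab : AreIndependent a b)
    (hba : AreIndependent b a) (ha : IsLetterAction a) (hb : IsLetterAction b) {k : ℤ}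
    (hk : 2 ≤ k) {f : W L →₀ ℂ} (hf : f ∈ sphere L k) (hfa : shift (-1) a f = 0)
    (hfb : shift (-1) b f = 0) {m n m' n' : ℕ} (hmn : m + n = m' + n') :
    (shift (-1) a ^ m') ((shift (-1) b ^ n') ((shift 1 a ^ m) ((shift 1 b ^ n) f))) =
      if m = m' ∧ n = n' then ((L : ℂ) - 1) ^ (m + n) • f else 0 := by
  have hn := shift_pow_mem_sphere 1 b hf n
  have pass (j : ℕ) (hj : j ≤ n) := hab.shift_neg_pow_shift_one_pow ha hb (k := k + n * 1) j
    (by omega) hn m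
  rcases lt_trichotomy n n' with h | rfl | h
  · obtain ⟨i, rfl⟩ := Nat.exists_eq_add_of_lt h
    rw [if_neg (by omega), add_assoc, add_comm, pow_add, Module.End.mul_apply, pass n le_rfl,
      hb.shift_neg_pow_shift_one_pow (by omega) hf, pow_succ, Module.End.mul_apply,
      map_smul, map_smul, hab.shift_neg_shift_one_pow ha hb hk hf, hfb]
    simp
  · obtain rfl : m = m' := by omega
    rw [if_pos ⟨rfl, rfl⟩, pass n le_rfl, hb.shift_neg_pow_shift_one_pow (by omega) hf, map_smul,
      map_smul, ha.shift_neg_pow_shift_one_pow (by omega) hf, smul_smul, pow_add, mul_comm]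
  · obtain ⟨i, rfl⟩ := Nat.exists_eq_add_of_lt h
    obtain rfl : m' = i + 1 + m := by omega
    have hi := shift_pow_mem_sphere 1 b hf (i + 1)
    have hki : 1 ≤ k + (i + 1 : ℕ) * 1 := by omega
    rw [if_neg (by omega), pass n' h.le, add_assoc n' i 1, pow_add (shift 1 b) n' (i + 1),
      Module.End.mul_apply, hb.shift_neg_pow_shift_one_pow hki hi, map_smul, map_smul,
      pow_add (shift (-1) a) (i + 1) m,
      Module.End.mul_apply, ha.shift_neg_pow_shift_one_pow hki hi, map_smul,
      pow_succ (shift (-1) a), Module.End.mul_apply, hba.shift_neg_shift_one_pow hb ha hk hf, hfa]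
    simp

/-- The inclusion of the finitely supported functions into `ℓ²(W)`. -/
def incl (L : ℕ) : (W L →₀ ℂ) →ₗ[ℂ] H L := Finsupp.linearCombination ℂ δ

lemma incl_single (w : W L) : incl L (Finsupp.single w 1) = δ w := by simp [incl]

/-- The span of the `δ w` with `ε * len w < k`. -/
def below (L : ℕ) (ε k : ℤ) : Submodule ℂ (H L) :=
  Submodule.span ℂ {x : H L | ∃ w : W L, ε * len w < k ∧ x = δ w}

lemma δ_mem_below {ε k : ℤ} {w : W L} (h : ε * len w < k) : δ w ∈ below L ε k :=
  Submodule.subset_span ⟨w, h, rfl⟩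

lemma below_mono {ε k k' : ℤ} (h : k ≤ k') : below L ε k ≤ below L ε k' := by
  refine Submodule.span_mono ?_
  rintro _ ⟨w, hw, rfl⟩
  exact ⟨w, hw.trans_le h, rfl⟩

lemma below_le_comap {ε k k' : ℤ} {A : H L →L[ℂ] H L}
    (h : ∀ w : W L, ε * len w < k → A (δ w) ∈ below L ε k') :
    below L ε k ≤ (below L ε k').comap A.toLinearMap := by
  rw [below, Submodule.span_le]
  rintro _ ⟨w, hw, rfl⟩
  exact h w hw

lemma incl_mem_below {ε k k' : ℤ} (h : ε * k < k') {f : W L →₀ ℂ} (hf : f ∈ sphere L k) :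
    incl L f ∈ below L ε k' := by
  induction hf using sphere_induction with
  | single w hw => rw [incl_single]; exact δ_mem_below (hw ▸ h)
  | zero => simp
  | add f g _ _ hf hg => rw [map_add]; exact add_mem hf hg
  | smul c f _ hf => rw [map_smul]; exact Submodule.smul_mem _ _ hf

/-- The operators `T s`, `Tw w` and `hn n` associated with a letter action. -/
structure IsHeckeFamily (act : Fin L → W L → W L) (p : ℂ) (T : Fin L → H L →L[ℂ] H L)
    (Tw : W L → H L →L[ℂ] H L) (hn : ℕ → H L →L[ℂ] H L) : Prop where
  isLetterAction : IsLetterAction act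
  apply_δ (s : Fin L) (w : W L) :
    T s (δ w) = if len (act s w) < len w then δ (act s w) + p • δ w else δ (act s w)
  one : Tw 1 = 1
  comp (s : Fin L) (w : W L) : len (act s w) < len w → Tw w = T s ∘L Tw (act s w)
  tsum_eq (n : ℕ) : hn n = ∑' w : {w : W L // len w = n}, Tw (w : W L)

namespace IsHeckeFamily

variable {act : Fin L → W L → W L} {p : ℂ} {T : Fin L → H L →L[ℂ] H L}
  {Tw : W L → H L →L[ℂ] H L} {hn : ℕ → H L →L[ℂ] H L} (hT : IsHeckeFamily act p T Tw hn)
  {ε : ℤ}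
include hT

lemma exists_apply_δ (s : Fin L) (w : W L) : ∃ c : ℂ, T s (δ w) = δ (act s w) + c • δ w := by
  rw [hT.apply_δ]
  split_ifs
  · exact ⟨p, rfl⟩
  · exact ⟨0, by simp⟩

lemma apply_apply_δ (s : Fin L) (w : W L) : T s (T s (δ w)) = δ w + p • T s (δ w) := by
  have h := hT.isLetterAction.involutive s w
  by_cases hw : len (act s w) < len w
  · have h₁ : T s (δ w) = δ (act s w) + p • δ w := by rw [hT.apply_δ, if_pos hw]
    have h₂ : T s (δ (act s w)) = δ w := by
      rw [hT.apply_δ, h, if_neg (by omega)]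
    conv_lhs => rw [h₁, map_add, map_smul, h₂]
  · have h₁ : T s (δ w) = δ (act s w) := by rw [hT.apply_δ, if_neg hw]
    have h₂ : T s (δ (act s w)) = δ w + p • δ (act s w) := by
      have := hT.isLetterAction.len_act s w
      rw [hT.apply_δ, h, if_pos (by omega)]
    rw [h₁, h₂]

lemma mul_len_act_le (hε : ε = 1 ∨ ε = -1) (s : Fin L) (w : W L) :
    ε * len (act s w) ≤ ε * len w + 1 := by
  have := hT.isLetterAction.len_act s w
  rcases hε with rfl | rfl <;> omega

lemma apply_mem_below (hε : ε = 1 ∨ ε = -1) (s : Fin L) {k : ℤ} {x : H L}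
    (hx : x ∈ below L ε k) : T s x ∈ below L ε (k + 1) := by
  refine below_le_comap (fun w hw => ?_) hx
  obtain ⟨c, hc⟩ := hT.exists_apply_δ s w
  have := hT.mul_len_act_le hε s w
  rw [hc]
  exact add_mem (δ_mem_below (by omega)) (Submodule.smul_mem _ _ (δ_mem_below (by omega)))

lemma apply_apply_mem_below (hε : ε = 1 ∨ ε = -1) (s : Fin L) {k : ℤ} {x : H L}
    (hx : x ∈ below L ε k) : T s (T s x) ∈ below L ε (k + 1) := by
  refine below_le_comap (A := T s ∘L T s) (fun w hw => ?_) hx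
  rw [ContinuousLinearMap.comp_apply, hT.apply_apply_δ]
  exact add_mem (δ_mem_below (by omega))
    (Submodule.smul_mem _ _ (hT.apply_mem_below hε s (δ_mem_below hw)))

lemma word_apply_mem_below (hε : ε = 1 ∨ ε = -1) (w : W L) {k : ℤ} {x : H L}
    (hx : x ∈ below L ε k) : Tw w x ∈ below L ε (k + len w) := by
  induction h : len w generalizing w with
  | zero =>
    obtain rfl : w = 1 := (cs L).length_eq_zero_iff.1 h
    simpa [hT.one] using hx
  | succ n ih =>
    obtain ⟨s, hs, -⟩ := hT.isLetterAction.existsUnique_descent w (by omega)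
    have := hT.isLetterAction.len_act s w
    rw [hT.comp s w hs]
    have := hT.apply_mem_below hε s (ih (act s w) (by omega))
    rwa [add_assoc, ← Nat.cast_succ] at this

lemma eq_sum (n : ℕ) : hn n = ∑ w ∈ (finite_len_eq (L := L) n).toFinset, Tw w := by
  have : Fintype {w : W L // len w = n} := (finite_len_eq n).fintype
  rw [hT.tsum_eq, tsum_fintype,
    ← Finset.sum_subtype (finite_len_eq n).toFinset (p := fun w => len w = n) (by simp) Tw]

lemma zero_eq : hn 0 = 1 := by
  rw [hT.eq_sum, Finset.sum_eq_single 1]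
  · exact hT.one
  · intro w hw hw1
    exact absurd ((cs L).length_eq_zero_iff.1 (show len w = 0 by simpa using hw)) hw1
  · intro h
    exact absurd (show len (1 : W L) = 0 from (cs L).length_one) (by simpa using h)

lemma sphere_apply_mem_below (hε : ε = 1 ∨ ε = -1) (n : ℕ) {k : ℤ} {x : H L}
    (hx : x ∈ below L ε k) : hn n x ∈ below L ε (k + n) := by
  rw [hT.eq_sum, sum_apply]
  refine Submodule.sum_mem _ fun w hw => ?_
  have hw : len w = n := by simpa using hw
  exact hw ▸ hT.word_apply_mem_below hε w hx

lemma sphere_succ_eq (n : ℕ) : hn (n + 1) =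
    ∑ s, ∑ w ∈ (finite_len_eq (L := L) n).toFinset with len w < len (act s w), T s ∘L Tw w := by
  have ha := hT.isLetterAction
  have h (w) (hw : w ∈ (finite_len_eq (L := L) (n + 1)).toFinset) :
      Tw w = ∑ s, if len (act s w) < len w then T s ∘L Tw (act s w) else 0 := by
    have hw : len w = n + 1 := by simpa using hw
    obtain ⟨s, hs, hsu⟩ := ha.existsUnique_descent w (by omega)
    rw [Finset.sum_eq_single s, if_pos hs, hT.comp s w hs]
    · intro t _ ht
      rw [if_neg fun h => ht (hsu t h)]
    · simp
  rw [hT.eq_sum, Finset.sum_congr rfl h, Finset.sum_comm]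
  refine Finset.sum_congr rfl fun s _ => ?_
  rw [← Finset.sum_filter]
  refine Finset.sum_bij' (fun w _ => act s w) (fun w _ => act s w) ?_ ?_ ?_ ?_ ?_
  · intro w hw
    have := ha.len_act s w
    simp only [Finset.mem_filter, Set.Finite.mem_toFinset, Set.mem_ofPred_eq,
      ha.involutive] at hw ⊢
    omega
  · intro w hw
    have := ha.len_act s w
    simp only [Finset.mem_filter, Set.Finite.mem_toFinset, Set.mem_ofPred_eq,
      ha.involutive] at hw ⊢
    omega
  · exact fun w _ => ha.involutive s w
  · exact fun w _ => ha.involutive s w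
  · exact fun w _ => rfl

/-- Multiplying by the generating operator agrees with passing to the next sphere, up to terms
which are one step shorter. -/
lemma sum_apply_sub_sphere_succ_mem_below (hε : ε = 1 ∨ ε = -1) (n : ℕ) {k : ℤ} {x : H L}
    (hx : x ∈ below L ε k) :
    (∑ s, T s) (hn n x) - hn (n + 1) x ∈ below L ε (k + n) := by
  have ha := hT.isLetterAction
  have h : (∑ s, T s) (hn n x) - hn (n + 1) x =
      ∑ s, ∑ w ∈ (finite_len_eq (L := L) n).toFinset with ¬ len w < len (act s w),
        T s (Tw w x) := by
    rw [hT.sphere_succ_eq, hT.eq_sum n]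
    simp only [sum_apply, map_sum, ContinuousLinearMap.comp_apply]
    rw [Finset.sum_comm, ← Finset.sum_sub_distrib]
    refine Finset.sum_congr rfl fun s _ => ?_
    rw [sub_eq_iff_eq_add', Finset.sum_filter_add_sum_filter_not]
  rw [h]
  refine Submodule.sum_mem _ fun s _ => Submodule.sum_mem _ fun w hw => ?_
  simp only [Finset.mem_filter, Set.Finite.mem_toFinset, Set.mem_ofPred_eq] at hw
  have h₁ := ha.len_act s w
  rw [hT.comp s w (by omega)]
  have := hT.apply_apply_mem_below hε s (hT.word_apply_mem_below hε (act s w) hx)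
  exact below_mono (by omega) this

lemma sum_apply_incl_sub_mem_below (hε : ε = 1 ∨ ε = -1) {k : ℤ} {f : W L →₀ ℂ}
    (hf : f ∈ sphere L k) :
    (∑ s, T s) (incl L f) - incl L (shift ε act f) ∈ below L ε (ε * k + 1) := by
  classical
  induction hf using sphere_induction with
  | single w hw =>
    rw [incl_single, shift_single, sum_apply, map_sum,
      ← Finset.sum_sub_distrib]
    refine Submodule.sum_mem _ fun s _ => ?_
    obtain ⟨c, hc⟩ := hT.exists_apply_δ s w
    have h₁ := hT.isLetterAction.len_act s w
    rw [hc]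
    subst hw
    split_ifs with h
    · rw [incl_single, add_sub_cancel_left]
      exact Submodule.smul_mem _ _ (δ_mem_below (by omega))
    · rw [map_zero, sub_zero]
      refine add_mem (δ_mem_below ?_) (Submodule.smul_mem _ _ (δ_mem_below (by omega)))
      rcases hε with rfl | rfl <;> omega
  | zero => simp
  | add f g _ _ hf hg =>
    simp only [map_add]
    rw [add_sub_add_comm]
    exact add_mem hf hg
  | smul c f _ hf =>
    simp only [map_smul]
    rw [← smul_sub]
    exact Submodule.smul_mem _ _ hf

/-- The extreme part of `hn n` on a sphere is the `n`-th power of the shift. -/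
lemma sphere_apply_incl_sub_mem_below (hε : ε = 1 ∨ ε = -1) {k : ℤ} {f : W L →₀ ℂ}
    (hf : f ∈ sphere L k) (n : ℕ) :
    hn n (incl L f) - incl L ((shift ε act ^ n) f) ∈ below L ε (ε * k + n) := by
  induction n with
  | zero => simp [hT.zero_eq]
  | succ n ih =>
    have hεε : ε * ε = 1 := by rcases hε with rfl | rfl <;> rfl
    have h₁ := hT.sum_apply_sub_sphere_succ_mem_below hε n
      (incl_mem_below (lt_add_one (ε * k)) hf)
    have h₂ : (∑ s, T s) (hn n (incl L f) - incl L ((shift ε act ^ n) f)) ∈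
        below L ε (ε * k + n + 1) := by
      rw [sum_apply]
      exact Submodule.sum_mem _ fun s _ => hT.apply_mem_below hε s ih
    have h₃ := hT.sum_apply_incl_sub_mem_below hε (shift_pow_mem_sphere ε act hf n)
    have e₁ : ε * k + 1 + n = ε * k + (n + 1 : ℕ) := by push_cast; ring
    have e₂ : ε * k + n + 1 = ε * k + (n + 1 : ℕ) := by push_cast; ring
    have e₃ : ε * (k + n * ε) + 1 = ε * k + (n + 1 : ℕ) := by
      push_cast
      linear_combination (n : ℤ) * hεε
    rw [e₁] at h₁
    rw [e₂] at h₂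
    rw [e₃] at h₃
    have := sub_mem (add_mem h₂ h₃) h₁
    rw [map_sub] at this
    rw [pow_succ', Module.End.mul_apply]
    convert this using 1
    abel

end IsHeckeFamily

lemma projection_eq_zero {Q : ℕ → H L →L[ℂ] H L}
    (hQ : ∀ (l : ℕ) (w : W L), Q l (δ w) = if len w = l then δ w else 0) {ε : ℤ} {l : ℕ}
    {x : H L} (hx : x ∈ below L ε (ε * l)) : Q l x = 0 := by
  induction hx using Submodule.span_induction with
  | mem x hx =>
    obtain ⟨w, hw, rfl⟩ := hx
    rw [hQ, if_neg]
    rintro rfl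
    exact lt_irrefl _ hw
  | zero => simp
  | add x y _ _ hx hy => rw [map_add, hx, hy, add_zero]
  | smul c x _ hx => rw [map_smul, hx, smul_zero]

lemma projection_incl {Q : ℕ → H L →L[ℂ] H L}
    (hQ : ∀ (l : ℕ) (w : W L), Q l (δ w) = if len w = l then δ w else 0) {l : ℕ}
    {f : W L →₀ ℂ} (hf : f ∈ sphere L l) : Q l (incl L f) = incl L f := by
  induction hf using sphere_induction with
  | single w hw => rw [incl_single, hQ, if_pos (by exact_mod_cast hw)]
  | zero => simp
  | add f g _ _ hf hg => simp only [map_add, hf, hg]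
  | smul c f _ hf => simp only [map_smul, hf]

/-- The extreme part of `hn m ∘ hnr n`, for two families of operators, is given by shifts. -/
lemma projection_apply_apply_incl {a b : Fin L → W L → W L} {p p' : ℂ}
    {T Tr : Fin L → H L →L[ℂ] H L} {Tw Twr : W L → H L →L[ℂ] H L} {hn hnr : ℕ → H L →L[ℂ] H L}
    (hT : IsHeckeFamily a p T Tw hn) (hTr : IsHeckeFamily b p' Tr Twr hnr)
    {Q : ℕ → H L →L[ℂ] H L}
    (hQ : ∀ (l : ℕ) (w : W L), Q l (δ w) = if len w = l then δ w else 0)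
    {ε : ℤ} (hε : ε = 1 ∨ ε = -1) {k : ℤ} {f : W L →₀ ℂ} (hf : f ∈ sphere L k) {m n l : ℕ}
    (hl : k + (m + n) * ε = l) :
    Q l (hn m (hnr n (incl L f))) = incl L ((shift ε a ^ m) ((shift ε b ^ n) f)) := by
  have hεε : ε * ε = 1 := by rcases hε with rfl | rfl <;> rfl
  have hn' := shift_pow_mem_sphere ε b hf n
  have h₁ := hT.sphere_apply_mem_below hε m (hTr.sphere_apply_incl_sub_mem_below hε hf n)
  have h₂ := hT.sphere_apply_incl_sub_mem_below hε hn' m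
  have h₃ := shift_pow_mem_sphere ε a hn' m
  have e₁ : ε * k + n + m = ε * l := by
    linear_combination ε * hl - (m + n : ℤ) * hεε
  have e₂ : ε * (k + n * ε) + m = ε * l := by
    linear_combination ε * hl - (m : ℤ) * hεε
  have e₃ : k + n * ε + m * ε = l := by linear_combination hl
  rw [e₁] at h₁
  rw [e₂] at h₂
  rw [e₃] at h₃
  have h := projection_eq_zero hQ (add_mem h₁ h₂)
  rw [map_sub, sub_add_sub_cancel, map_sub, projection_incl hQ h₃] at h
  exact sub_eq_zero.1 h

lemma inner_incl_δ (f : W L →₀ ℂ) (w : W L) : ⟪incl L f, δ w⟫ = starRingEnd ℂ (f w) := by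
  classical
  induction f using Finsupp.induction_linear with
  | zero => simp
  | add f g hf hg => rw [map_add, inner_add_left, hf, hg, Finsupp.add_apply, map_add]
  | single x c =>
    have : ⟪(δ x : H L), δ w⟫ = if x = w then 1 else 0 := by
      rw [δ, δ, lp.inner_single_right, lp.single_apply, Pi.single_apply]
      simp only [eq_comm (a := w)]
      split_ifs <;> simp
    rw [incl, Finsupp.linearCombination_single, inner_smul_left, this, Finsupp.single_apply]
    split_ifs <;> simp

lemma exists_incl_eq {l : ℕ} {x : H L} (hx : x ∈ V L l) : ∃ f ∈ sphere L l, incl L f = x := by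
  induction hx using Submodule.span_induction with
  | mem x hx =>
    obtain ⟨w, rfl, rfl⟩ := hx
    exact ⟨_, single_mem_sphere w, incl_single w⟩
  | zero => exact ⟨0, zero_mem _, map_zero _⟩
  | add x y _ _ hx hy =>
    obtain ⟨f, hf, rfl⟩ := hx
    obtain ⟨g, hg, rfl⟩ := hy
    exact ⟨f + g, add_mem hf hg, map_add _ _ _⟩
  | smul c x _ hx =>
    obtain ⟨f, hf, rfl⟩ := hx
    exact ⟨c • f, Submodule.smul_mem _ _ hf, map_smul _ _ _⟩

/-- Vectors orthogonal to the range of the raising operator are killed by the lowering one. -/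
lemma IsHeckeFamily.shift_neg_eq_zero {act : Fin L → W L → W L} {p : ℂ}
    {T : Fin L → H L →L[ℂ] H L} {Tw : W L → H L →L[ℂ] H L} {hn : ℕ → H L →L[ℂ] H L}
    (hT : IsHeckeFamily act p T Tw hn) {Q : ℕ → H L →L[ℂ] H L}
    (hQ : ∀ (l : ℕ) (w : W L), Q l (δ w) = if len w = l then δ w else 0) {l : ℕ} (hl : 1 ≤ l)
    {f : W L →₀ ℂ} (hf : f ∈ sphere L l)
    (hperp : ∀ y ∈ V L (l - 1), ⟪incl L f, Q l ((∑ s, T s) y)⟫ = 0) :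
    shift (-1) act f = 0 := by
  classical
  ext v
  rw [Finsupp.zero_apply]
  by_cases hv : len v = l - 1
  · have h := hperp (δ v) (Submodule.subset_span ⟨v, hv, rfl⟩)
    have hsv := single_mem_sphere v
    have h₁ := hT.sum_apply_incl_sub_mem_below (Or.inl rfl) hsv
    have h₂ := shift_mem_sphere 1 act hsv
    have e : (len v : ℤ) + 1 = l := by omega
    rw [one_mul, e, ← one_mul (l : ℤ)] at h₁
    rw [e] at h₂
    have h₃ := projection_eq_zero hQ h₁
    rw [map_sub, projection_incl hQ h₂, sub_eq_zero, incl_single] at h₃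
    rw [h₃, shift_single, map_sum, inner_sum] at h
    rw [shift_neg_apply hT.isLetterAction, ← map_eq_zero (starRingEnd ℂ), map_sum]
    refine (Finset.sum_congr rfl fun s _ => ?_).trans h
    split_ifs
    · rw [incl_single, inner_incl_δ]
    · simp
  · have := shift_mem_sphere (-1) act hf
    rw [sphere, Finsupp.mem_supported'] at this
    exact this v (by simp only [Set.mem_ofPred_eq]; omega)

end

theorem statement10
    (L : ℕ) (hL : 3 ≤ L) (q p : ℝ) (hq : 0 < q) (hq1 : q ≤ 1)
    (hp : p = (q - 1) / Real.sqrt q)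
    (T : Fin L → H L →L[ℂ] H L)
    (hT : ∀ (s : Fin L) (w : W L),
      T s (δ w) =
        if len (σ s * w) < len w then δ (σ s * w) + (p : ℂ) • δ w else δ (σ s * w))
    (h : H L →L[ℂ] H L) (hh : h = ∑ s, T s)
    (Tw : W L → H L →L[ℂ] H L) (hTw1 : Tw 1 = 1)
    (hTwrec : ∀ (s : Fin L) (w : W L), len (σ s * w) < len w →
      Tw w = T s ∘L Tw (σ s * w))
    (hn : ℕ → H L →L[ℂ] H L)
    (hhn : ∀ n : ℕ, hn n = ∑' w : {w : W L // len w = n}, Tw (w : W L))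
    (Tr : Fin L → H L →L[ℂ] H L)
    (hTr : ∀ (s : Fin L) (w : W L),
      Tr s (δ w) =
        if len (w * σ s) < len w then δ (w * σ s) + (p : ℂ) • δ w else δ (w * σ s))
    (Rh : H L →L[ℂ] H L) (hRh : Rh = ∑ s, Tr s)
    (Twr : W L → H L →L[ℂ] H L) (hTwr1 : Twr 1 = 1)
    (hTwrrec : ∀ (s : Fin L) (w : W L), len (w * σ s) < len w →
      Twr w = Tr s ∘L Twr (w * σ s))
    (hnr : ℕ → H L →L[ℂ] H L)
    (hhnr : ∀ n : ℕ, hnr n = ∑' w : {w : W L // len w = n}, Twr (w : W L))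
    (Q : ℕ → H L →L[ℂ] H L)
    (hQ : ∀ (l : ℕ) (w : W L), Q l (δ w) = if len w = l then δ w else 0)
    (l : ℕ) (hl : 2 ≤ l) (ξ : H L)
    (hξmem : ξ ∈ V L l)
    (hξperp : ∀ y ∈ Sl L Q h Rh l, ⟪ξ, y⟫ = 0)
    (m n m' n' : ℕ) (hmn : m + n = m' + n') :
    Q l (hn m' (hnr n' (Q (m + n + l) (hn m (hnr n ξ))))) =
      if m = m' ∧ n = n' then (((L : ℂ) - 1) ^ (m + n)) • ξ else 0 := by
  have hLeft : IsHeckeFamily (fun (s : Fin L) (w : W L) => σ s * w) p T Tw hn :=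
    ⟨isLetterAction_left, hT, hTw1, hTwrec, hhn⟩
  have hRight : IsHeckeFamily (fun (s : Fin L) (w : W L) => w * σ s) p Tr Twr hnr :=
    ⟨isLetterAction_right, hTr, hTwr1, hTwrrec, hhnr⟩
  obtain ⟨f, hf, rfl⟩ := exists_incl_eq hξmem
  have hfl := hLeft.shift_neg_eq_zero hQ (by omega) hf fun y hy =>
    hξperp _ (Submodule.subset_span (Or.inl ⟨y, hy, by rw [hh]⟩))
  have hfr := hRight.shift_neg_eq_zero hQ (by omega) hf fun y hy =>
    hξperp _ (Submodule.subset_span (Or.inr ⟨y, hy, by rw [hRh]⟩))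
  rw [projection_apply_apply_incl hLeft hRight hQ (Or.inl rfl) hf (by push_cast; ring),
    projection_apply_apply_incl hLeft hRight hQ (Or.inr rfl)
      (shift_pow_mem_sphere 1 _ (shift_pow_mem_sphere 1 _ hf n) m) (by omega),
    shift_orthogonality areIndependent_left_right areIndependent_right_left isLetterAction_left
      isLetterAction_right (by exact_mod_cast hl) hf hfl hfr hmn]
  split_ifs
  · rw [map_smul]
  · rw [map_zero]

end UCoxMasa
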